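/- The reduced optimal control error admits the intermediate bound ‖u*_h(μ) − u*_N(μ)‖_{L²(Ω)} ≤ α^{−1/2} ε̲⁻¹ ε̄ ‖Ê_h(μ) − E*_N(μ)‖_{H(curl;Ω)} + α⁻¹ ε̲⁻¹ ε̄ ‖F̂_h(μ) − F*_N(μ)‖_{H(curl;Ω)}. -/

import Mathlib

/- Abstract functional-analytic formalization of the parameterized Maxwell
optimal control problem of the paper.  `V` plays the role of `L²(Ω)³`,
`S` of `L²(Ω)`, `Hc` of `H₀(curl;Ω)` (with `emb` the embedding into `L²`
and `curl` the curl operator, so that the `H(curl)` inner product is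
`⟪emb ·, emb ·⟫ + ⟪curl ·, curl ·⟫`), and `H10` of `H¹₀(Ω)` (with `grad`
the gradient into `L²(Ω)³` and `embS` the embedding into `L²(Ω)`).
The multiplication operators by `σ⁻¹(·;μ)` and `ε(·;μ)` are the symmetric
operators `invσ μ` and `eps μ`, with the pointwise bounds
`σ̲ = σlo ≤ σ ≤ σhi = σ̄`, `ε̲ = εlo ≤ ε ≤ εhi = ε̄` encoded as quadratic-form
and operator-norm bounds; `ρ μ` is the charge density, `volΩ = |Ω|`,
`Dproj` is multiplication by the indicator of `D ⊂ Ω`. -/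

open scoped RealInnerProductSpace BigOperators
open Filter

noncomputable section

/-- Young's inequality `⟪T p, q⟫ ≤ ⟪T q, q⟫ + ¼⟪T p, p⟫` for a symmetric positive operator. -/
theorem inner_sub_inner_self_le_of_symm_nonneg {V : Type*} [NormedAddCommGroup V]
    [InnerProductSpace ℝ V] (T : V →L[ℝ] V) (hsym : ∀ v w, ⟪T v, w⟫ = ⟪v, T w⟫)
    (hpos : ∀ v, 0 ≤ ⟪T v, v⟫) (p q : V) :
    ⟪T p, q⟫ - ⟪T q, q⟫ ≤ 1 / 4 * ⟪T p, p⟫ := by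
  have h := hpos ((1 / 2 : ℝ) • p - q)
  have hqp : ⟪T q, p⟫ = ⟪T p, q⟫ := by rw [hsym, real_inner_comm]
  simp only [map_sub, map_smul, inner_sub_left, inner_sub_right, real_inner_smul_left,
    real_inner_smul_right, hqp] at h
  linarith

theorem real_inner_apply_le_of_opNorm_le {V : Type*} [NormedAddCommGroup V] [InnerProductSpace ℝ V]
    {T : V →L[ℝ] V} {C : ℝ} (hT : ‖T‖ ≤ C) (v w : V) : ⟪T v, w⟫ ≤ C * ‖v‖ * ‖w‖ :=
  (real_inner_le_norm _ _).trans <| by gcongr; exact T.le_of_opNorm_le hT v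

theorem le_add_of_sq_le_mul_add_sq {x a b : ℝ} (ha : 0 ≤ a) (hb : 0 ≤ b)
    (h : x ^ 2 ≤ a * x + b ^ 2) : x ≤ b + a := by
  nlinarith [mul_nonneg ha hb]

/-- Intermediate bound for the reduced control error:
`‖u*_h − u*_N‖_{L²} ≤ α^{−1/2} ε̲⁻¹ ε̄ ‖Ê_h − E*_N‖_{H(curl)}
  + α⁻¹ ε̲⁻¹ ε̄ ‖F̂_h − F*_N‖_{H(curl)}`. -/
theorem statement16
    {p : ℕ} {P : Set (EuclideanSpace ℝ (Fin p))} (hP : IsCompact P)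
    {V S Hc H10 : Type}
    [NormedAddCommGroup V] [InnerProductSpace ℝ V] [CompleteSpace V]
    [NormedAddCommGroup S] [InnerProductSpace ℝ S] [CompleteSpace S]
    [NormedAddCommGroup Hc] [InnerProductSpace ℝ Hc] [CompleteSpace Hc]
    [NormedAddCommGroup H10] [InnerProductSpace ℝ H10] [CompleteSpace H10]
    (emb curl : Hc →L[ℝ] V) (grad : H10 →L[ℝ] V) (embS : H10 →L[ℝ] S)
    (hHc : ∀ Φ Ψ : Hc, ⟪Φ, Ψ⟫ = ⟪emb Φ, emb Ψ⟫ + ⟪curl Φ, curl Ψ⟫)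
    (εlo εhi σlo σhi ρlo ρhi : ℝ)
    (hεlo : 0 < εlo) (hεle : εlo ≤ εhi) (hσlo : 0 < σlo) (hσle : σlo ≤ σhi)
    (hρle : ρlo ≤ ρhi)
    (invσ eps : P → V →L[ℝ] V) (ρ : P → S)
    (hσsym : ∀ (μ : P) (v w : V), ⟪invσ μ v, w⟫ = ⟪v, invσ μ w⟫)
    (hσlb : ∀ (μ : P) (v : V), σhi⁻¹ * ‖v‖ ^ 2 ≤ ⟪invσ μ v, v⟫)
    (hσub : ∀ μ : P, ‖invσ μ‖ ≤ σlo⁻¹)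
    (hεsym : ∀ (μ : P) (v w : V), ⟪eps μ v, w⟫ = ⟪v, eps μ w⟫)
    (hεlb : ∀ (μ : P) (v : V), εlo * ‖v‖ ^ 2 ≤ ⟪eps μ v, v⟫)
    (hεub : ∀ μ : P, ‖eps μ‖ ≤ εhi)
    (volΩ : ℝ) (hvol : 0 < volΩ)
    (hρb : ∀ μ : P, ‖ρ μ‖ ≤ Real.sqrt volΩ * ρhi)
    (ubar : ℝ) (hubar : 0 ≤ ubar) (Uad : Set V)
    (hUadConv : Convex ℝ Uad) (hUadNe : Uad.Nonempty)
    (hUadGauss : ∀ (μ : P), ∀ u ∈ Uad, ∀ φ : H10, ⟪eps μ u, grad φ⟫ = 0)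
    (hUadBdd : ∀ u ∈ Uad, ‖u‖ ≤ Real.sqrt volΩ * ubar)
    (CΩσ : ℝ) (hCΩσ : 0 < CΩσ)
    (hcoer : ∀ (μ : P) (v : Hc),
        (∀ φ : H10, ⟪eps μ (emb v), grad φ⟫ = 0) →
        ‖v‖ ^ 2 ≤ CΩσ * ⟪invσ μ (curl v), curl v⟫)
    (gradc : H10 →L[ℝ] Hc)
    (hgradc₁ : ∀ φ : H10, emb (gradc φ) = grad φ)
    (hgradc₂ : ∀ φ : H10, curl (gradc φ) = 0)
    (Eh : Submodule ℝ Hc) (Vh : Submodule ℝ H10)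
    (hgradVh : ∀ φ ∈ Vh, gradc φ ∈ Eh)
    (hcoerh : ∀ (μ : P) (v : Hc), v ∈ Eh →
        (∀ φ ∈ Vh, ⟪eps μ (emb v), grad φ⟫ = 0) →
        ‖v‖ ^ 2 ≤ CΩσ * ⟪invσ μ (curl v), curl v⟫)
    (EN : Submodule ℝ Hc) (VN : Submodule ℝ H10) (hEN : EN ≤ Eh) (hVN : VN ≤ Vh)
    (hcoerN : ∀ (μ : P) (v : Hc), v ∈ EN →
        (∀ φ ∈ VN, ⟪eps μ (emb v), grad φ⟫ = 0) →
        ‖v‖ ^ 2 ≤ CΩσ * ⟪invσ μ (curl v), curl v⟫)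
    (α : ℝ) (hα : 0 < α)
    (Dproj : V →L[ℝ] V)
    (hDsym : ∀ v w : V, ⟪Dproj v, w⟫ = ⟪v, Dproj w⟫)
    (hDidem : ∀ v : V, Dproj (Dproj v) = Dproj v)
    (hDcomm : ∀ (μ : P) (v : V), Dproj (eps μ v) = eps μ (Dproj v))
    (hDnorm : ‖Dproj‖ ≤ 1)
    (Ed ud : P → V) (ed udb : ℝ)
    (hEdb : ∀ μ : P, ‖Dproj (Ed μ)‖ ≤ ed) (hudb : ∀ μ : P, ‖ud μ‖ ≤ udb)
    (μ : P)
    (uh : V) (Eha Fha : Hc)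
    (huh : uh ∈ Uad) (hEhamem : Eha ∈ Eh) (hFhamem : Fha ∈ Eh)
    (hSh1 : ∀ Φ ∈ Eh, ⟪invσ μ (curl Eha), curl Φ⟫ = ⟪eps μ uh, emb Φ⟫)
    (hSh2 : ∀ φ ∈ Vh, ⟪eps μ (emb Eha), grad φ⟫ = -⟪ρ μ, embS φ⟫)
    (hAh1 : ∀ Φ ∈ Eh, ⟪invσ μ (curl Fha), curl Φ⟫ = ⟪Dproj (eps μ (emb Eha - Ed μ)), emb Φ⟫)
    (hAh2 : ∀ φ ∈ Vh, ⟪eps μ (emb Fha), grad φ⟫ = 0)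
    (hVIh : ∀ u ∈ Uad, ⟪eps μ (u - uh), ud μ - α⁻¹ • emb Fha - uh⟫ ≤ 0)
    (uN : V) (ENa FNa : Hc)
    (huN : uN ∈ Uad) (hENamem : ENa ∈ EN) (hFNamem : FNa ∈ EN)
    (hSN1 : ∀ Φ ∈ EN, ⟪invσ μ (curl ENa), curl Φ⟫ = ⟪eps μ uN, emb Φ⟫)
    (hSN2 : ∀ φ ∈ VN, ⟪eps μ (emb ENa), grad φ⟫ = -⟪ρ μ, embS φ⟫)
    (hAN1 : ∀ Φ ∈ EN, ⟪invσ μ (curl FNa), curl Φ⟫ = ⟪Dproj (eps μ (emb ENa - Ed μ)), emb Φ⟫)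
    (hAN2 : ∀ φ ∈ VN, ⟪eps μ (emb FNa), grad φ⟫ = 0)
    (hVIN : ∀ u ∈ Uad, ⟪eps μ (u - uN), ud μ - α⁻¹ • emb FNa - uN⟫ ≤ 0)
    (Ehat Fhat : Hc) (hEhatmem : Ehat ∈ Eh) (hFhatmem : Fhat ∈ Eh)
    (hHat1 : ∀ Φ ∈ Eh, ⟪invσ μ (curl Ehat), curl Φ⟫ = ⟪eps μ uN, emb Φ⟫)
    (hHat2 : ∀ φ ∈ Vh, ⟪eps μ (emb Ehat), grad φ⟫ = -⟪ρ μ, embS φ⟫)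
    (hHat3 : ∀ Φ ∈ Eh, ⟪invσ μ (curl Fhat), curl Φ⟫ = ⟪Dproj (eps μ (emb ENa - Ed μ)), emb Φ⟫)
    (hHat4 : ∀ φ ∈ Vh, ⟪eps μ (emb Fhat), grad φ⟫ = 0)
    :
    ‖uh - uN‖ ≤
      (Real.sqrt α)⁻¹ * εlo⁻¹ * εhi * ‖Ehat - ENa‖ +
        α⁻¹ * εlo⁻¹ * εhi * ‖Fhat - FNa‖ := by
  have hemb (v : Hc) : ‖emb v‖ ≤ ‖v‖ := by
    have h := hHc v v
    simp only [real_inner_self_eq_norm_sq] at h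
    exact (sq_le_sq₀ (norm_nonneg _) (norm_nonneg _)).1 (by nlinarith [sq_nonneg ‖curl v‖])
  have hεhi : 0 < εhi := hεlo.trans_le hεle
  have hDeps (v w : V) : ⟪Dproj (eps μ v), w⟫ = ⟪eps μ (Dproj v), Dproj w⟫ := by
    rw [← hDidem, hDsym, hDcomm]
  have hvar : ⟪eps μ (uh - uN), uh - uN⟫ ≤
      α⁻¹ * (⟪eps μ (uh - uN), emb (FNa - Fhat)⟫ + ⟪eps μ (uh - uN), emb (Fhat - Fha)⟫) := by
    have h₁ := hVIh uN huN
    have h₂ := hVIN uh huh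
    simp only [map_sub, inner_sub_left, inner_sub_right, real_inner_smul_right] at h₁ h₂ ⊢
    linarith
  have hadj : ⟪eps μ (uh - uN), emb (Fhat - Fha)⟫ =
      ⟪Dproj (eps μ (emb (ENa - Eha))), emb (Eha - Ehat)⟫ := by
    have hF := Eh.sub_mem hFhatmem hFhamem
    have hE := Eh.sub_mem hEhamem hEhatmem
    have h₁ := hSh1 _ hF
    have h₂ := hHat1 _ hF
    have h₃ := hAh1 _ hE
    have h₄ := hHat3 _ hE
    have h₅ : ⟪invσ μ (curl (Eha - Ehat)), curl (Fhat - Fha)⟫ =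
        ⟪invσ μ (curl (Fhat - Fha)), curl (Eha - Ehat)⟫ := by
      rw [hσsym, real_inner_comm]
    simp only [map_sub, inner_sub_left, inner_sub_right] at h₁ h₂ h₃ h₄ h₅ ⊢
    linarith
  have hstate : ⟪Dproj (eps μ (emb (ENa - Eha))), emb (Eha - Ehat)⟫ ≤
      1 / 4 * (εhi * ‖Ehat - ENa‖ ^ 2) := by
    have hpos (v : V) : 0 ≤ ⟪eps μ v, v⟫ := (by positivity : 0 ≤ εlo * ‖v‖ ^ 2).trans (hεlb μ v)
    have hY := inner_sub_inner_self_le_of_symm_nonneg (eps μ) (hεsym μ) hpos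
      (Dproj (emb (ENa - Ehat))) (Dproj (emb (Eha - Ehat)))
    have hD : ‖Dproj (emb (ENa - Ehat))‖ ≤ ‖Ehat - ENa‖ := by
      rw [norm_sub_rev Ehat]
      exact (Dproj.le_of_opNorm_le hDnorm _).trans (by rw [one_mul]; exact hemb _)
    have hb := real_inner_apply_le_of_opNorm_le (hεub μ)
      (Dproj (emb (ENa - Ehat))) (Dproj (emb (ENa - Ehat)))
    have hsq : εhi * ‖Dproj (emb (ENa - Ehat))‖ * ‖Dproj (emb (ENa - Ehat))‖ ≤
        εhi * ‖Ehat - ENa‖ ^ 2 := by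
      rw [mul_assoc, ← sq]
      gcongr
    have hsplit : ENa - Eha = (ENa - Ehat) - (Eha - Ehat) := by abel
    rw [hDeps, hsplit, map_sub emb (ENa - Ehat), map_sub Dproj, map_sub (eps μ), inner_sub_left]
    linarith
  have hadjoint : ⟪eps μ (uh - uN), emb (FNa - Fhat)⟫ ≤ εhi * ‖uh - uN‖ * ‖Fhat - FNa‖ := by
    refine (real_inner_apply_le_of_opNorm_le (hεub μ) _ _).trans ?_
    rw [norm_sub_rev Fhat]
    gcongr
    exact hemb _
  have hmain : εlo * ‖uh - uN‖ ^ 2 ≤ α⁻¹ * (εhi * ‖uh - uN‖ * ‖Fhat - FNa‖ +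
      1 / 4 * (εhi * ‖Ehat - ENa‖ ^ 2)) := by
    refine (hεlb μ _).trans (hvar.trans ?_)
    rw [hadj]
    gcongr
  refine le_add_of_sq_le_mul_add_sq (by positivity) (by positivity) ?_
  have hratio : 1 ≤ εlo⁻¹ * εhi := by
    rw [inv_mul_eq_div]
    exact (one_le_div hεlo).2 hεle
  have hratio_sq : 1 / 4 * (εlo⁻¹ * εhi) ≤ (εlo⁻¹ * εhi) ^ 2 := by nlinarith
  calc ‖uh - uN‖ ^ 2 = εlo⁻¹ * (εlo * ‖uh - uN‖ ^ 2) := by field_simp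
    _ ≤ εlo⁻¹ * (α⁻¹ * (εhi * ‖uh - uN‖ * ‖Fhat - FNa‖ +
        1 / 4 * (εhi * ‖Ehat - ENa‖ ^ 2))) := by gcongr
    _ = α⁻¹ * εlo⁻¹ * εhi * ‖Fhat - FNa‖ * ‖uh - uN‖ +
        α⁻¹ * (1 / 4 * (εlo⁻¹ * εhi)) * ‖Ehat - ENa‖ ^ 2 := by ring
    _ ≤ α⁻¹ * εlo⁻¹ * εhi * ‖Fhat - FNa‖ * ‖uh - uN‖ +
        α⁻¹ * (εlo⁻¹ * εhi) ^ 2 * ‖Ehat - ENa‖ ^ 2 := by gcongr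
    _ = _ := by
      have hs : (Real.sqrt α)⁻¹ ^ 2 = α⁻¹ := by rw [inv_pow, Real.sq_sqrt hα.le]
      rw [← hs]
      ring

end
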